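/- arXiv:1503.08487 — 3 statements merged into one kernel-verified Lean document; each statement's English description precedes it below -/
import Mathlib

section
/- Let G be a finite group and let L be its lattice of normal subgroups (ordered by inclusion). If L is a simple lattice, then the following are equivalent: (1) the clone Comp(G) of congruence preserving functions of G is finitely generated; (2) L does not split, or L has at most 2 elements. -/
/-- A finitary operation on `A`. -/
abbrev FinOp (A : Type*) := Σ n : ℕ, (Fin n → A) → A

/-- Membership in the clone generated by a set `F` of finitary operations:
the smallest set of finitary operations containing `F` and all projections
and closed under composition. -/
inductive InClone {A : Type*} (F : Set (FinOp A)) : {n : ℕ} → ((Fin n → A) → A) → Prop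
  | proj {n : ℕ} (i : Fin n) : InClone F fun x => x i
  | base {n : ℕ} (f : (Fin n → A) → A) : (⟨n, f⟩ : FinOp A) ∈ F → InClone F f
  | comp {n m : ℕ} (f : (Fin m → A) → A) (g : Fin m → (Fin n → A) → A) :
      InClone F f → (∀ i, InClone F (g i)) → InClone F fun x => f fun i => g i x

/-- A function `G^k → G` is compatible (congruence preserving): it preserves
every congruence, i.e. for every normal subgroup `N` and tuples `a ≡ b mod N`
one has `f a ≡ f b mod N`. -/
def Compatible {G : Type*} [Group G] {k : ℕ} (f : (Fin k → G) → G) : Prop :=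
  ∀ N : Subgroup G, N.Normal → ∀ a b : Fin k → G,
    (∀ i, (a i)⁻¹ * b i ∈ N) → (f a)⁻¹ * f b ∈ N

/-- The clone `Comp G` of congruence preserving functions of `G` is finitely
generated: some finite set of compatible functions generates, as a clone,
exactly the compatible functions (of all arities `≥ 1`). -/
def CompFG (G : Type*) [Group G] : Prop :=
  ∃ F : Set (FinOp G), F.Finite ∧ (∀ f ∈ F, 1 ≤ f.1 ∧ Compatible f.2) ∧
    ∀ (n : ℕ), 1 ≤ n → ∀ f : (Fin n → G) → G, (Compatible f ↔ InClone F f)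

/-- The lattice of normal subgroups of `G`. -/
instance NormalSubgroup.instLattice {G : Type*} [Group G] :
    Lattice {N : Subgroup G // N.Normal} :=
  Subtype.lattice (fun _ _ hA hB => @Subgroup.sup_normal _ _ _ _ hA hB)
    (fun _ _ hA hB => @Subgroup.normal_inf_normal _ _ _ _ hA hB)

instance NormalSubgroup.instBoundedOrder {G : Type*} [Group G] :
    BoundedOrder {N : Subgroup G // N.Normal} where
  top := ⟨⊤, inferInstance⟩
  le_top A := (le_top : A.1 ≤ ⊤)
  bot := ⟨⊥, inferInstance⟩
  bot_le A := (bot_le : ⊥ ≤ A.1)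

/-- A lattice congruence: an equivalence relation compatible with `⊓` and `⊔`. -/
def IsLatticeCong {L : Type*} [Lattice L] (r : L → L → Prop) : Prop :=
  Equivalence r ∧ ∀ a b c d : L, r a b → r c d → r (a ⊓ c) (b ⊓ d) ∧ r (a ⊔ c) (b ⊔ d)

/-- A lattice is simple if it has at least two elements and its only lattice
congruences are equality and the total relation. -/
def SimpleLattice (L : Type*) [Lattice L] : Prop :=
  Nontrivial L ∧ ∀ r : L → L → Prop, IsLatticeCong r →
    (∀ a b : L, r a b ↔ a = b) ∨ (∀ a b : L, r a b)

/-- A bounded lattice splits if it has a splitting pair `(δ, ε)`. -/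
def LatticeSplits (L : Type*) [Lattice L] [BoundedOrder L] : Prop :=
  ∃ δ ε : L, δ < ⊤ ∧ ⊥ < ε ∧ ∀ α : L, α ≤ δ ∨ ε ≤ α

section Clone

variable {G : Type*} [Group G]

theorem compatible_iff {k : ℕ} {f : (Fin k → G) → G} :
    Compatible f ↔ ∀ N : Subgroup G, N.Normal → ∀ a b : Fin k → G,
      (∀ i, (a i : G ⧸ N) = b i) → (f a : G ⧸ N) = f b := by
  simp only [Compatible, QuotientGroup.eq]

namespace Compatible

theorem proj {k : ℕ} (i : Fin k) : Compatible fun x : Fin k → G => x i :=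
  fun _ _ _ _ h => h i

theorem const (k : ℕ) (g : G) : Compatible fun _ : Fin k → G => g := by
  intro N _ a b _
  simp

theorem comp {k m : ℕ} {f : (Fin m → G) → G} {g : Fin m → (Fin k → G) → G}
    (hf : Compatible f) (hg : ∀ i, Compatible (g i)) : Compatible fun x => f fun i => g i x :=
  fun N hN a b h => hf N hN _ _ fun i => hg i N hN a b h

theorem mul {k : ℕ} {f g : (Fin k → G) → G} (hf : Compatible f) (hg : Compatible g) :
    Compatible fun x => f x * g x := by
  rw [compatible_iff] at *
  intro N hN a b h
  rw [QuotientGroup.mk_mul, QuotientGroup.mk_mul, hf N hN a b h, hg N hN a b h]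

theorem inv {k : ℕ} {f : (Fin k → G) → G} (hf : Compatible f) :
    Compatible fun x => (f x)⁻¹ := by
  rw [compatible_iff] at *
  intro N hN a b h
  rw [QuotientGroup.mk_inv, QuotientGroup.mk_inv, hf N hN a b h]

theorem of_inClone {F : Set (FinOp G)} (hF : ∀ f ∈ F, Compatible f.2) {n : ℕ}
    {f : (Fin n → G) → G} (hf : InClone F f) : Compatible f := by
  induction hf with
  | proj i => exact proj i
  | base f h => exact hF _ h
  | comp f g _ _ ihf ihg => exact ihf.comp ihg

end Compatible

variable (G) in
/-- The compatible functions of arity between `1` and `K`. -/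
def compUpTo (K : ℕ) : Set (FinOp G) :=
  {f | 1 ≤ f.1 ∧ f.1 ≤ K ∧ Compatible f.2}

theorem finite_compUpTo [Finite G] (K : ℕ) : (compUpTo G K).Finite := by
  refine Set.Finite.subset (Set.Finite.biUnion (Set.finite_Iic K)
    (t := fun n => Set.range fun f : (Fin n → G) → G => (⟨n, f⟩ : FinOp G))
    fun n _ => Set.finite_range _) ?_
  rintro ⟨n, f⟩ ⟨_, h, _⟩
  simp only [Set.mem_iUnion]
  exact ⟨n, h, f, rfl⟩

theorem InClone.mul {K : ℕ} (hK : 2 ≤ K) {m : ℕ} {f g : (Fin m → G) → G}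
    (hf : InClone (compUpTo G K) f) (hg : InClone (compUpTo G K) g) :
    InClone (compUpTo G K) fun x => f x * g x := by
  have h : InClone (compUpTo G K) fun x : Fin 2 → G => x 0 * x 1 :=
    .base _ ⟨by simp, hK, (Compatible.proj 0).mul (Compatible.proj 1)⟩
  exact h.comp _ ![f, g] (Fin.forall_fin_two.2 ⟨hf, hg⟩)

theorem InClone.const {K : ℕ} (hK : 1 ≤ K) {m : ℕ} (hm : 1 ≤ m) (g : G) :
    InClone (compUpTo G K) fun _ : Fin m → G => g := by
  have h : InClone (compUpTo G K) fun _ : Fin 1 → G => g :=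
    .base _ ⟨le_rfl, hK, .const 1 g⟩
  exact h.comp _ (fun _ x => x ⟨0, hm⟩) fun _ => .proj _

theorem compFG_of_step [Finite G] {K : ℕ} (hK : 1 ≤ K)
    (step : ∀ m, K ≤ m → (∀ f : (Fin m → G) → G, Compatible f → InClone (compUpTo G K) f) →
      ∀ f : (Fin (m + 1) → G) → G, Compatible f → InClone (compUpTo G K) f) :
    CompFG G := by
  refine ⟨compUpTo G K, finite_compUpTo K, fun f hf => ⟨hf.1, hf.2.2⟩, fun n hn f =>
    ⟨fun hf => ?_, Compatible.of_inClone fun f hf => hf.2.2⟩⟩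
  rcases le_total n K with hnK | hnK
  · exact .base _ ⟨hn, hnK, hf⟩
  · induction n, hnK using Nat.le_induction with
    | base => exact .base _ ⟨hn, le_rfl, hf⟩
    | succ m hm ih => exact step m hm (fun f hf => ih (hK.trans hm) f hf) f hf

end Clone

section TwoElementLattice

variable {G : Type*} [Group G] [Finite G]

theorem normal_eq_bot_or_eq_top_of_card_le
    (h : Nat.card {N : Subgroup G // N.Normal} ≤ 2) (N : Subgroup G) (hN : N.Normal) :
    N = ⊥ ∨ N = ⊤ := by
  by_contra! hc
  have hbt : (⊥ : Subgroup G) ≠ ⊤ := fun hbt =>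
    hc.1 (le_bot_iff.1 (hbt ▸ le_top))
  let e : Fin 3 → {N : Subgroup G // N.Normal} := ![⊥, ⟨N, hN⟩, ⊤]
  have he : Function.Injective e := by
    have h01 : (⊥ : {N : Subgroup G // N.Normal}) ≠ ⟨N, hN⟩ := fun h =>
      hc.1 (congrArg Subtype.val h).symm
    have h02 : (⊥ : {N : Subgroup G // N.Normal}) ≠ ⊤ := fun h =>
      hbt (congrArg Subtype.val h)
    have h12 : (⟨N, hN⟩ : {N : Subgroup G // N.Normal}) ≠ ⊤ := fun h =>
      hc.2 (congrArg Subtype.val h)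
    have h21 := h12.symm
    intro i j hij
    fin_cases i <;> fin_cases j <;> simp_all [e]
  have := Nat.card_le_card_of_injective e he
  simp at this
  omega

open Classical in
theorem compFG_of_card_le (h : Nat.card {N : Subgroup G // N.Normal} ≤ 2) : CompFG G := by
  have hall : ∀ {k : ℕ} (f : (Fin k → G) → G), Compatible f := by
    intro k f N hN a b hab
    rcases normal_eq_bot_or_eq_top_of_card_le h N hN with rfl | rfl
    · have : a = b := funext fun i => by simpa [inv_mul_eq_one] using hab i
      simp [this]
    · trivial
  refine compFG_of_step (K := 2) (by norm_num) fun m hm ih f _ => ?_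
  have := Fintype.ofFinite G
  let t : G → (Fin (m + 1) → G) → G := fun a x =>
    if x 0 = a then f (Fin.cons a (Fin.tail x)) else 1
  have ht : ∀ a, InClone (compUpTo G 2) (t a) := by
    intro a
    have h1 : InClone (compUpTo G 2) fun y : Fin 2 → G => if y 0 = a then y 1 else 1 :=
      .base _ ⟨by simp, le_rfl, hall _⟩
    have h2 : InClone (compUpTo G 2) fun x : Fin (m + 1) → G => f (Fin.cons a (Fin.tail x)) :=
      (ih (fun y => f (Fin.cons a y)) (hall _)).comp _ (fun i x => x i.succ) fun i => .proj _
    exact h1.comp _ ![fun x => x 0, fun x => f (Fin.cons a (Fin.tail x))]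
      (Fin.forall_fin_two.2 ⟨.proj _, h2⟩)
  have hprod : ∀ l : List G, InClone (compUpTo G 2) fun x => (l.map fun a => t a x).prod := by
    intro l
    induction l with
    | nil => simpa using InClone.const (K := 2) (by norm_num) (by omega) 1
    | cons a l ihl => simpa using (ht a).mul le_rfl ihl
  have hmem : ∀ (l : List G), l.Nodup → ∀ x,
      (l.map fun a => t a x).prod = if x 0 ∈ l then f x else 1 := by
    intro l hl x
    induction l with
    | nil => simp
    | cons a l ihl =>
      rw [List.nodup_cons] at hl
      rw [List.map_cons, List.prod_cons, ihl hl.2]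
      by_cases hx : x 0 = a
      · subst hx
        simp [t, hl.1]
      · simp [t, hx]
  convert hprod Finset.univ.toList using 2 with x
  rw [hmem _ (Finset.nodup_toList _)]
  simp

end TwoElementLattice

section NonSplitting

variable {G : Type*} [Group G]

/-- `f` takes the value `1` as soon as one of the coordinates in `s` is `1`. -/
def AbsorbsAt {k : ℕ} (s : Finset (Fin k)) (f : (Fin k → G) → G) : Prop :=
  ∀ i ∈ s, ∀ x : Fin k → G, x i = 1 → f x = 1

theorem Compatible.comp_update {k : ℕ} {f : (Fin k → G) → G} (hf : Compatible f) (i : Fin k)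
    {g : (Fin k → G) → G} (hg : Compatible g) :
    Compatible fun x => f (Function.update x i (g x)) := by
  refine hf.comp (g := fun j x => Function.update x i (g x) j) fun j => ?_
  rcases eq_or_ne j i with rfl | h
  · simpa using hg
  · simpa [h] using Compatible.proj j

theorem iSup_normal_eq_top_of_not_latticeSplits
    (h : ¬ LatticeSplits {N : Subgroup G // N.Normal}) {e : G} (he : e ≠ 1) :
    ⨆ N : {N : Subgroup G // N.Normal ∧ e ∉ N}, N.1 = ⊤ := by
  by_contra hne
  have hnormal : (⨆ N : {N : Subgroup G // N.Normal ∧ e ∉ N}, N.1).Normal := by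
    have : ∀ N : {N : Subgroup G // N.Normal ∧ e ∉ N}, N.1.Normal := fun N => N.2.1
    exact Subgroup.iSup_normal _
  refine h ⟨⟨_, hnormal⟩, ⟨Subgroup.normalClosure {e}, inferInstance⟩, ?_, ?_, ?_⟩
  · exact lt_top_iff_ne_top.2 fun h => hne (congrArg Subtype.val h)
  · refine bot_lt_iff_ne_bot.2 fun h => he ?_
    have h' : Subgroup.normalClosure {e} = ⊥ := congrArg Subtype.val h
    rw [← Subgroup.mem_bot, ← h']
    exact Subgroup.subset_normalClosure rfl
  · rintro ⟨N, hN⟩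
    by_cases heN : e ∈ N
    · exact Or.inr (Subgroup.normalClosure_le_normal (by simpa using heN))
    · exact Or.inl (le_iSup (fun N : {N : Subgroup G // N.Normal ∧ e ∉ N} => N.1) ⟨N, hN, heN⟩)

/-- If the lattice of normal subgroups does not split, compatible functions of large arity that
are absorbing at all coordinates are constant. -/
theorem eq_one_of_absorbsAt_univ [Finite G] (h : ¬ LatticeSplits {N : Subgroup G // N.Normal})
    {m : ℕ} (hm : Nat.card G ≤ m) {c : (Fin m → G) → G} (hc : Compatible c)
    (habs : AbsorbsAt Finset.univ c) (x : Fin m → G) : c x = 1 := by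
  obtain ⟨e, he⟩ : ∃ e : Fin m → G, Function.Surjective e := by
    have := Fintype.ofFinite G
    refine Function.exists_surjective_iff.2 ⟨⟨fun _ => 1⟩, ?_⟩
    rw [Nat.card_eq_fintype_card] at hm
    exact Function.Embedding.nonempty_of_card_le (by simpa using hm)
  suffices H : ∀ s : Finset (Fin m), ∀ c : (Fin m → G) → G, Compatible c →
      AbsorbsAt Finset.univ c → ∀ x : Fin m → G,
      (∀ i ∉ s, e i ≠ 1 → ∃ N : Subgroup G, N.Normal ∧ e i ∉ N ∧ x i ∈ N) → c x = 1 from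
    H Finset.univ c hc habs x (by simp)
  clear x hc habs c
  intro s
  induction s using Finset.induction_on with
  | empty =>
    intro c hc habs x hx
    by_contra hne
    obtain ⟨i, hi⟩ := he (c x)
    obtain ⟨N, hN, heN, hxN⟩ := hx i (by simp) (hi ▸ hne)
    have h1 := compatible_iff.1 hc N hN x (Function.update x i 1) fun j => by
      rcases eq_or_ne j i with rfl | hj
      · simpa using hxN
      · simp [hj]
    rw [habs i (Finset.mem_univ i) (Function.update x i 1) (by simp)] at h1
    exact heN (hi ▸ by simpa using h1)
  | insert i s his ih =>
    intro c hc habs x hx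
    by_cases hei : e i = 1
    · refine ih c hc habs x fun j hj hej => hx j ?_ hej
      rintro hj'
      rcases Finset.mem_insert.1 hj' with rfl | hj'
      exacts [hej hei, hj hj']
    have key : ∀ z ∈ ⨆ N : {N : Subgroup G // N.Normal ∧ e i ∉ N}, N.1,
        ∀ c : (Fin m → G) → G, Compatible c → AbsorbsAt Finset.univ c →
        c (Function.update x i z) = 1 := by
      intro z hz
      refine Subgroup.iSup_induction _ (C := fun z => ∀ c : (Fin m → G) → G, Compatible c →
        AbsorbsAt Finset.univ c → c (Function.update x i z) = 1) hz ?_ ?_ ?_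
      · intro N z hz c hc habs
        refine ih c hc habs _ fun j hj hej => ?_
        rcases eq_or_ne j i with rfl | hji
        · exact ⟨N, N.2.1, N.2.2, by simpa using hz⟩
        · simpa [hji] using hx j (by simp [hji, hj]) hej
      · exact fun c _ habs => habs i (Finset.mem_univ i) _ (by simp)
      · intro z₁ z₂ h₁ h₂ c hc habs
        let d : (Fin m → G) → G := fun y =>
          c (Function.update y i (y i * z₂)) * (c (Function.update y i z₂))⁻¹
        have hd : Compatible d :=
          (hc.comp_update i ((Compatible.proj i).mul (.const m z₂))).mul
            (hc.comp_update i (.const m z₂)).inv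
        have hdabs : AbsorbsAt Finset.univ d := by
          intro j _ y hy
          rcases eq_or_ne j i with rfl | hji
          · simp [d, hy]
          · simp only [d]
            rw [habs j (Finset.mem_univ j) _ (by simpa [hji] using hy),
              habs j (Finset.mem_univ j) _ (by simpa [hji] using hy)]
            simp
        have := h₁ d hd hdabs
        simpa [d, h₂ c hc habs] using this
    have := key (x i) (by
      rw [iSup_normal_eq_top_of_not_latticeSplits h hei]; trivial) c hc habs
    simpa using this

theorem compFG_of_not_latticeSplits [Finite G]
    (h : ¬ LatticeSplits {N : Subgroup G // N.Normal}) : CompFG G := by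
  have hK : 2 ≤ Nat.card G + 2 := by omega
  refine compFG_of_step (K := Nat.card G + 2) (by omega) fun m hm ih f hf => ?_
  suffices H : ∀ s : Finset (Fin (m + 1)), ∀ f : (Fin (m + 1) → G) → G, Compatible f →
      AbsorbsAt sᶜ f → InClone (compUpTo G (Nat.card G + 2)) f from
    H Finset.univ f hf (by simp [AbsorbsAt])
  intro s
  induction s using Finset.induction_on with
  | empty =>
    intro f hf habs
    rw [funext (eq_one_of_absorbsAt_univ h (by omega) hf (by simpa using habs))]
    exact .const (by omega) (by omega) 1
  | insert i s his ihs =>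
    intro f hf habs
    let f₁ : (Fin (m + 1) → G) → G := fun x => f (Function.update x i 1)
    have hf₁ : Compatible f₁ := hf.comp_update i (.const _ 1)
    have hclone : InClone (compUpTo G (Nat.card G + 2)) f₁ := by
      have h1 := ih (fun y => f (Fin.insertNth i 1 y))
        (hf.comp (g := fun j y => (Fin.insertNth i 1 y : Fin (m + 1) → G) j) fun j => by
          induction j using Fin.succAboveCases i with
          | x => simpa using .const m 1
          | p j => simpa using .proj j)
      have h2 := h1.comp _ (fun j x => x (i.succAbove j)) fun j => .proj _
      have h3 : f₁ = fun x => f (Fin.insertNth i 1 fun j => x (i.succAbove j)) :=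
        funext fun x => congrArg f (Fin.insertNth_removeNth i 1 x).symm
      exact h3 ▸ h2
    have hrest := ihs (fun x => f x * (f₁ x)⁻¹) (hf.mul hf₁.inv) (by
      intro j hj x hx
      rcases eq_or_ne j i with rfl | hji
      · have : Function.update x j 1 = x := by rw [← hx, Function.update_eq_self]
        simp [f₁, this]
      · have hj' : j ∈ (insert i s)ᶜ := by simpa [hji] using hj
        simp only [f₁]
        rw [habs j hj' x hx, habs j hj' _ (by simpa [hji] using hx)]
        simp)
    simpa using hrest.mul hK hclone

end NonSplitting

section LatticeCommutator

variable {L : Type*} [Lattice L] [BoundedOrder L] [Finite L]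

theorem card_le_two_of_simpleLattice_of_sup_ne_top (hL : SimpleLattice L)
    (h : ∀ a b : L, a ≠ ⊤ → b ≠ ⊤ → a ⊔ b ≠ ⊤) : Nat.card L ≤ 2 := by
  have := hL.1
  have hcong : IsLatticeCong fun a b : L => a = ⊤ ↔ b = ⊤ := by
    refine ⟨⟨fun _ => Iff.rfl, Iff.symm, Iff.trans⟩, fun a b c d hab hcd => ⟨?_, ?_⟩⟩
    · simp only [inf_eq_top_iff, hab, hcd]
    · have hsup : ∀ a b : L, a ⊔ b = ⊤ ↔ a = ⊤ ∨ b = ⊤ := by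
        intro a b
        refine ⟨fun hab => ?_, ?_⟩
        · by_contra! hne
          exact h a b hne.1 hne.2 hab
        · rintro (rfl | rfl) <;> simp
      simp only [hsup, hab, hcd]
  rcases hL.2 _ hcong with heq | htot
  · have huniv : (Set.univ : Set L) ⊆ {⊥, ⊤} := by
      intro a _
      by_cases ha : a = ⊤
      · exact Or.inr ha
      · exact Or.inl ((heq a ⊥).1 (by simp [ha]))
    rw [← Set.ncard_univ]
    exact (Set.ncard_le_ncard huniv (Set.toFinite _)).trans ((Set.ncard_insert_le _ _).trans (by simp))
  · exact absurd ((htot ⊤ ⊥).1 rfl) bot_ne_top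

theorem commutator_top_ne_self (hL : SimpleLattice L) (hcard : ¬ Nat.card L ≤ 2)
    (C : L → L → L) (hleft : ∀ a b, C a b ≤ a) (hright : ∀ a b, C a b ≤ b)
    (hmono : ∀ a b b', b ≤ b' → C a b ≤ C a b')
    (hsup_left : ∀ a a' b, C (a ⊔ a') b ≤ C a b ⊔ C a' b)
    (hsup_right : ∀ a b b', C a (b ⊔ b') ≤ C a b ⊔ C a b') {x : L} (hx : x ≠ ⊥) :
    C ⊤ x ≠ x := by
  have hiter_mono : ∀ z n, Monotone (C z)^[n] := fun z n =>
    Monotone.iterate (fun a b h => hmono z a b h) n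
  have hiter_le : ∀ z n a, (C z)^[n] a ≤ a := by
    intro z n a
    induction n with
    | zero => exact le_rfl
    | succ n ih => exact (Function.iterate_succ_apply' (C z) n a ▸ hright _ _).trans ih
  have hiter_anti : ∀ z n m a, (C z)^[n + m] a ≤ (C z)^[m] a := fun z n m a => by
    rw [Function.iterate_add_apply]
    exact hiter_le z n _
  have hiter_sup : ∀ z n a b, (C z)^[n] (a ⊔ b) ≤ (C z)^[n] a ⊔ (C z)^[n] b := by
    intro z n a b
    induction n with
    | zero => exact le_rfl
    | succ n ih =>
      simp only [Function.iterate_succ_apply']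
      exact (hmono _ _ _ ih).trans (hsup_right _ _ _)
  have hcong : ∀ z, IsLatticeCong fun a b : L =>
      ∃ n, (C z)^[n] a ≤ b ∧ (C z)^[n] b ≤ a := by
    intro z
    refine ⟨⟨fun a => ⟨0, le_rfl, le_rfl⟩, ?_, ?_⟩, ?_⟩
    · rintro a b ⟨n, h, h'⟩
      exact ⟨n, h', h⟩
    · rintro a b c ⟨n, h₁, h₂⟩ ⟨m, h₃, h₄⟩
      refine ⟨n + m, ?_, ?_⟩
      · rw [add_comm, Function.iterate_add_apply]
        exact (hiter_mono z m h₁).trans h₃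
      · rw [Function.iterate_add_apply]
        exact (hiter_mono z n h₄).trans h₂
    · rintro a b c d ⟨n, h₁, h₂⟩ ⟨m, h₃, h₄⟩
      have hn : ∀ u, (C z)^[n + m] u ≤ (C z)^[n] u := fun u => add_comm n m ▸ hiter_anti z m n u
      have hm : ∀ u, (C z)^[n + m] u ≤ (C z)^[m] u := fun u => hiter_anti z n m u
      refine ⟨⟨n + m, le_inf ?_ ?_, le_inf ?_ ?_⟩, ⟨n + m, ?_, ?_⟩⟩
      · exact (hn _).trans ((hiter_mono z n inf_le_left).trans h₁)
      · exact (hm _).trans ((hiter_mono z m inf_le_right).trans h₃)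
      · exact (hn _).trans ((hiter_mono z n inf_le_left).trans h₂)
      · exact (hm _).trans ((hiter_mono z m inf_le_right).trans h₄)
      · exact (hiter_sup _ _ _ _).trans (sup_le_sup ((hn _).trans h₁) ((hm _).trans h₃))
      · exact (hiter_sup _ _ _ _).trans (sup_le_sup ((hn _).trans h₂) ((hm _).trans h₄))
  have hdich : ∀ z, (∀ a, C z a = a) ∨ ∀ a, C z a = a → a = ⊥ := by
    intro z
    rcases hL.2 _ (hcong z) with heq | htot
    · exact Or.inl fun a => (heq _ _).1 ⟨1, (hiter_le z 1 _).trans (hright _ _), le_rfl⟩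
    · refine Or.inr fun a ha => ?_
      obtain ⟨n, h, -⟩ := htot a ⊥
      rw [Function.iterate_fixed ha] at h
      exact le_bot_iff.1 h
  have hnil : ∀ z, z ≠ ⊤ → ∀ a, C z a = a → a = ⊥ := fun z hz =>
    (hdich z).resolve_left fun h => hz (top_le_iff.1 ((h ⊤).symm.le.trans (hleft _ _)))
  refine fun hfix => hx ((hdich ⊤).resolve_left (fun htop => hcard ?_) x hfix)
  refine card_le_two_of_simpleLattice_of_sup_ne_top hL fun z₁ z₂ h₁ h₂ hz => ?_
  have := hL.1
  obtain ⟨a, ha⟩ := IsAtomic.exists_atom L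
  have hzero : ∀ z, z ≠ ⊤ → C z a = ⊥ := fun z hz =>
    (ha.le_iff.1 (hright z a)).resolve_right fun h => ha.1 (hnil z hz a h)
  have := hsup_left z₁ z₂ a
  rw [hz, htop, hzero z₁ h₁, hzero z₂ h₂, sup_bot_eq, le_bot_iff] at this
  exact ha.1 this

end LatticeCommutator

section Commutator

variable {G : Type*} [Group G]

/-- Compatibility of a function of `k + 1` arguments whose last argument is singled out. -/
def JointCompatible {k : ℕ} (c : (Fin k → G) → G → G) : Prop :=
  ∀ N : Subgroup G, N.Normal → ∀ (y y' : Fin k → G) (z z' : G),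
    (∀ i, (y i : G ⧸ N) = y' i) → (z : G ⧸ N) = z' → (c y z : G ⧸ N) = c y' z'

/-- The normal subgroup generated by the values, at tuples from `Z` and elements of `W`, of the
compatible functions that are `1` as soon as one of their two arguments is trivial. -/
def compCommutator (Z W : Subgroup G) : Subgroup G :=
  Subgroup.normalClosure {g | ∃ (k : ℕ) (c : (Fin k → G) → G → G), JointCompatible c ∧
    (∀ z, c 1 z = 1) ∧ (∀ y, c y 1 = 1) ∧ ∃ y : Fin k → G, (∀ i, y i ∈ Z) ∧ ∃ z ∈ W, c y z = g}

instance (Z W : Subgroup G) : (compCommutator Z W).Normal :=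
  Subgroup.normalClosure_normal

theorem mem_compCommutator {Z W : Subgroup G} {k : ℕ} {c : (Fin k → G) → G → G}
    (hc : JointCompatible c) (h₁ : ∀ z, c 1 z = 1) (h₂ : ∀ y, c y 1 = 1) {y : Fin k → G}
    (hy : ∀ i, y i ∈ Z) {z : G} (hz : z ∈ W) : c y z ∈ compCommutator Z W :=
  Subgroup.subset_normalClosure ⟨k, c, hc, h₁, h₂, y, hy, z, hz, rfl⟩

theorem compCommutator_le {Z W N : Subgroup G} [N.Normal]
    (h : ∀ (k : ℕ) (c : (Fin k → G) → G → G), JointCompatible c → (∀ z, c 1 z = 1) →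
      (∀ y, c y 1 = 1) → ∀ y : Fin k → G, (∀ i, y i ∈ Z) → ∀ z ∈ W, c y z ∈ N) :
    compCommutator Z W ≤ N := by
  refine Subgroup.normalClosure_le_normal ?_
  rintro _ ⟨k, c, hc, h₁, h₂, y, hy, z, hz, rfl⟩
  exact h k c hc h₁ h₂ y hy z hz

theorem compCommutator_mono_right {Z W W' : Subgroup G} (h : W ≤ W') :
    compCommutator Z W ≤ compCommutator Z W' :=
  compCommutator_le fun _ _ hc h₁ h₂ _ hy _ hz => mem_compCommutator hc h₁ h₂ hy (h hz)

theorem compCommutator_le_left (Z W : Subgroup G) [hZ : Z.Normal] : compCommutator Z W ≤ Z := by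
  refine compCommutator_le fun k c hc h₁ _ y hy z _ => ?_
  have := hc Z hZ y 1 z z (fun i => (QuotientGroup.eq_one_iff _).2 (hy i)) rfl
  rwa [h₁, QuotientGroup.mk_one, QuotientGroup.eq_one_iff] at this

theorem compCommutator_le_right (Z W : Subgroup G) [hW : W.Normal] :
    compCommutator Z W ≤ W := by
  refine compCommutator_le fun k c hc _ h₂ y _ z hz => ?_
  have := hc W hW y y z 1 (fun _ => rfl) ((QuotientGroup.eq_one_iff _).2 hz)
  rwa [h₂, QuotientGroup.mk_one, QuotientGroup.eq_one_iff] at this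

theorem compCommutator_sup_right (Z W W' : Subgroup G) [W.Normal] :
    compCommutator Z (W ⊔ W') ≤ compCommutator Z W ⊔ compCommutator Z W' := by
  refine compCommutator_le fun k c hc h₁ h₂ y hy z hz => ?_
  obtain ⟨a, ha, b, hb, rfl⟩ := Subgroup.mem_sup_of_normal_left.1 hz
  let d : (Fin k → G) → G → G := fun y z => c y (z * b) * (c y b)⁻¹
  have hd : JointCompatible d := by
    intro N hN y y' z z' hy hz
    simp only [d, QuotientGroup.mk_mul, QuotientGroup.mk_inv]
    rw [hc N hN y y' b b hy rfl, hc N hN y y' (z * b) (z' * b) hy (by simp [hz])]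
  have h : d y a ∈ compCommutator Z W :=
    mem_compCommutator hd (by simp [d, h₁]) (by simp [d]) hy ha
  have : c y (a * b) = d y a * c y b := by simp [d]
  rw [this]
  exact Subgroup.mul_mem_sup h (mem_compCommutator hc h₁ h₂ hy hb)

theorem compCommutator_sup_left (Z Z' W : Subgroup G) [Z.Normal] :
    compCommutator (Z ⊔ Z') W ≤ compCommutator Z W ⊔ compCommutator Z' W := by
  refine compCommutator_le fun k c hc h₁ h₂ y hy z hz => ?_
  choose a ha b hb hab using fun i => Subgroup.mem_sup_of_normal_left.1 (hy i)
  obtain rfl : a * b = y := funext hab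
  let d : (Fin k → G) → G → G := fun y z => c (y * b) z * (c b z)⁻¹
  have hd : JointCompatible d := by
    intro N hN y y' z z' hy hz
    simp only [d, QuotientGroup.mk_mul, QuotientGroup.mk_inv]
    rw [hc N hN b b z z' (fun _ => rfl) hz,
      hc N hN (y * b) (y' * b) z z' (fun i => by simp [hy i]) hz]
  have h : d a z ∈ compCommutator Z W :=
    mem_compCommutator hd (by simp [d]) (by simp [d, h₂]) ha hz
  have : c (a * b) z = d a z * c b z := by simp [d]
  rw [this]
  exact Subgroup.mul_mem_sup h (mem_compCommutator hc h₁ h₂ hb hz)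

theorem commutator_mem_compCommutator {W : Subgroup G} (y : G) {z : G} (hz : z ∈ W) :
    y * z * y⁻¹ * z⁻¹ ∈ compCommutator ⊤ W := by
  refine mem_compCommutator (k := 1) (c := fun y z => y 0 * z * (y 0)⁻¹ * z⁻¹) (y := fun _ => y) ?_
    (by simp) (by simp) (fun _ => Subgroup.mem_top _) hz
  intro N hN y y' z z' hy hz
  simp [hy, hz]

theorem compCommutator_top_lt [Finite G] (hL : SimpleLattice {N : Subgroup G // N.Normal})
    (hcard : ¬ Nat.card {N : Subgroup G // N.Normal} ≤ 2) {W : Subgroup G} [hW : W.Normal]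
    (hne : W ≠ ⊥) : compCommutator ⊤ W < W := by
  refine lt_of_le_of_ne (compCommutator_le_right _ _) fun h => ?_
  refine commutator_top_ne_self hL hcard
    (fun Z W => ⟨compCommutator Z.1 W.1, inferInstance⟩)
    (fun Z W => have := Z.2; compCommutator_le_left Z.1 W.1)
    (fun Z W => have := W.2; compCommutator_le_right Z.1 W.1)
    (fun Z W W' h => compCommutator_mono_right h)
    (fun Z Z' W => have := Z.2; compCommutator_sup_left Z.1 Z'.1 W.1)
    (fun Z W W' => have := W.2; compCommutator_sup_right Z.1 W.1 W'.1)
    (x := ⟨W, hW⟩) (fun h => hne (congrArg Subtype.val h)) (Subtype.ext h)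

end Commutator

section PrimePower

variable {G : Type*} [Group G]

theorem isLatticeCong_exists_pow_mem (p : ℕ) [Fact p.Prime] :
    IsLatticeCong fun N M : {N : Subgroup G // N.Normal} =>
      (∀ g ∈ N.1, ∃ n : ℕ, g ^ p ^ n ∈ M.1) ∧ ∀ g ∈ M.1, ∃ n : ℕ, g ^ p ^ n ∈ N.1 := by
  have hsup : ∀ A B C D : {N : Subgroup G // N.Normal},
      (∀ g ∈ A.1, ∃ n : ℕ, g ^ p ^ n ∈ B.1) → (∀ g ∈ C.1, ∃ n : ℕ, g ^ p ^ n ∈ D.1) →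
      ∀ g ∈ (A ⊔ C).1, ∃ n : ℕ, g ^ p ^ n ∈ (B ⊔ D).1 := by
    intro A B C D h₁ h₂ g hg
    have := (B ⊔ D).2
    have := A.2
    have hmap : ∀ (X Y : {N : Subgroup G // N.Normal}), Y ≤ B ⊔ D →
        (∀ g ∈ X.1, ∃ n : ℕ, g ^ p ^ n ∈ Y.1) →
        IsPGroup p (X.1.map (QuotientGroup.mk' (B ⊔ D).1)) := by
      rintro X Y hY h ⟨_, g, hg, rfl⟩
      obtain ⟨n, hn⟩ := h g hg
      refine ⟨n, Subtype.ext ?_⟩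
      simpa [← QuotientGroup.mk_pow] using hY hn
    have hnormal : (A.1.map (QuotientGroup.mk' (B ⊔ D).1)).Normal :=
      A.2.map _ (QuotientGroup.mk'_surjective _)
    have hp := (hmap A B le_sup_left h₁).to_sup_of_normal_left (hmap C D le_sup_right h₂)
    rw [← Subgroup.map_sup] at hp
    obtain ⟨n, hn⟩ := hp ⟨_, g, hg, rfl⟩
    refine ⟨n, ?_⟩
    have := congrArg Subtype.val hn
    simpa [← QuotientGroup.mk_pow] using this
  have hinf : ∀ A B C D : {N : Subgroup G // N.Normal},
      (∀ g ∈ A.1, ∃ n : ℕ, g ^ p ^ n ∈ B.1) → (∀ g ∈ C.1, ∃ n : ℕ, g ^ p ^ n ∈ D.1) →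
      ∀ g ∈ (A ⊓ C).1, ∃ n : ℕ, g ^ p ^ n ∈ (B ⊓ D).1 := by
    intro A B C D h₁ h₂ g hg
    obtain ⟨n, hn⟩ := h₁ g hg.1
    obtain ⟨m, hm⟩ := h₂ g hg.2
    refine ⟨n + m, ?_, ?_⟩
    · rw [pow_add, pow_mul]
      exact pow_mem hn _
    · rw [add_comm, pow_add, pow_mul]
      exact pow_mem hm _
  have htrans : ∀ A B C : {N : Subgroup G // N.Normal},
      (∀ g ∈ A.1, ∃ n : ℕ, g ^ p ^ n ∈ B.1) → (∀ g ∈ B.1, ∃ n : ℕ, g ^ p ^ n ∈ C.1) →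
      ∀ g ∈ A.1, ∃ n : ℕ, g ^ p ^ n ∈ C.1 := by
    intro A B C h₁ h₂ g hg
    obtain ⟨n, hn⟩ := h₁ g hg
    obtain ⟨m, hm⟩ := h₂ _ hn
    exact ⟨n + m, by rwa [pow_add, pow_mul]⟩
  have hrefl : ∀ A : {N : Subgroup G // N.Normal}, ∀ g ∈ A.1, ∃ n : ℕ, g ^ p ^ n ∈ A.1 :=
    fun A g hg => ⟨0, by simpa using hg⟩
  exact ⟨⟨fun A => ⟨hrefl A, hrefl A⟩, And.symm,
    fun h₁ h₂ => ⟨htrans _ _ _ h₁.1 h₂.1, htrans _ _ _ h₂.2 h₁.2⟩⟩,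
    fun A B C D h₁ h₂ => ⟨⟨hinf _ _ _ _ h₁.1 h₂.1, hinf _ _ _ _ h₁.2 h₂.2⟩,
      ⟨hsup _ _ _ _ h₁.1 h₂.1, hsup _ _ _ _ h₁.2 h₂.2⟩⟩⟩

theorem exists_isPGroup_of_simpleLattice [Finite G]
    (hL : SimpleLattice {N : Subgroup G // N.Normal}) {z : G} (hz : z ∈ Subgroup.center G)
    (hz1 : z ≠ 1) : ∃ p : ℕ, p.Prime ∧ IsPGroup p G := by
  obtain ⟨p, hp, hdvd⟩ := Nat.exists_prime_and_dvd (orderOf_eq_one_iff.not.2 hz1)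
  have := Fact.mk hp
  refine ⟨p, hp, ?_⟩
  have horder := orderOf_pow_orderOf_div (orderOf_pos z).ne' hdvd
  set g := z ^ (orderOf z / p) with hg
  have hgc : g ∈ Subgroup.center G := pow_mem hz _
  have hnormal : (Subgroup.zpowers g).Normal := by
    refine ⟨fun x hx h => ?_⟩
    have hxc := (Subgroup.zpowers_le.2 hgc) hx
    rw [Subgroup.mem_center_iff.1 hxc h]
    simpa using hx
  have hpow : ∀ x ∈ Subgroup.zpowers g, x ^ p ^ 1 = 1 := by
    rintro _ ⟨n, rfl⟩
    have : g ^ p = 1 := horder ▸ pow_orderOf_eq_one g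
    simp only [pow_one]
    rw [← zpow_natCast, zpow_comm, zpow_natCast, this, one_zpow]
  rcases hL.2 _ (isLatticeCong_exists_pow_mem (G := G) p) with heq | htot
  · have h : (⟨Subgroup.zpowers g, hnormal⟩ : {N : Subgroup G // N.Normal}) = ⊥ := by
      refine (heq _ _).1 ⟨fun x hx => ⟨1, ?_⟩, fun x hx => ⟨0, ?_⟩⟩
      · rw [hpow x hx]
        exact one_mem _
      · have : x = 1 := hx
        simp [this]
    have h' : Subgroup.zpowers g = ⊥ := congrArg Subtype.val h
    rw [Subgroup.zpowers_eq_bot] at h'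
    rw [h', orderOf_one] at horder
    exact absurd horder.symm hp.one_lt.ne'
  · exact fun g => ((htot ⊤ ⊥).1 g trivial).imp fun n hn => hn

end PrimePower

section Junta

variable {R X : Type*} [CommRing R]

/-- The span of the functions of `m` variables that depend on at most `d` of them. -/
def juntaSpan (R X : Type*) [CommRing R] (m d : ℕ) : Submodule R ((Fin m → X) → R) :=
  Submodule.span R {φ | ∃ S : Finset (Fin m), S.card ≤ d ∧ DependsOn φ (S : Set (Fin m))}

theorem juntaSpan_mono {m d d' : ℕ} (h : d ≤ d') : juntaSpan R X m d ≤ juntaSpan R X m d' :=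
  Submodule.span_mono fun _ ⟨S, hS, hφ⟩ => ⟨S, hS.trans h, hφ⟩

theorem const_mem_juntaSpan (m d : ℕ) (r : R) : (fun _ => r) ∈ juntaSpan R X m d :=
  Submodule.subset_span ⟨∅, by simp, fun _ _ _ => rfl⟩

theorem apply_mem_juntaSpan {m d : ℕ} (hd : 1 ≤ d) (u : X → R) (i : Fin m) :
    (fun x => u (x i)) ∈ juntaSpan R X m d :=
  Submodule.subset_span ⟨{i}, by simpa using hd, fun x y h => by simp [h i (by simp)]⟩

theorem mul_mem_juntaSpan {m a b : ℕ} {φ ψ : (Fin m → X) → R} (hφ : φ ∈ juntaSpan R X m a)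
    (hψ : ψ ∈ juntaSpan R X m b) : φ * ψ ∈ juntaSpan R X m (a + b) := by
  classical
  refine SetLike.le_def.1 ?_ (Submodule.mul_mem_mul hφ hψ)
  rw [juntaSpan, juntaSpan, Submodule.span_mul_span]
  refine Submodule.span_mono ?_
  rintro _ ⟨φ, ⟨S, hS, hφ⟩, ψ, ⟨T, hT, hψ⟩, rfl⟩
  refine ⟨S ∪ T, (Finset.card_union_le S T).trans (add_le_add hS hT), fun x y h => ?_⟩
  have h₁ : φ x = φ y := hφ fun i hi => h i (by simp_all)
  have h₂ : ψ x = ψ y := hψ fun i hi => h i (by simp_all)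
  simp [h₁, h₂]

theorem prod_mem_juntaSpan {ι : Type*} {m a : ℕ} {φ : ι → (Fin m → X) → R} (s : Finset ι)
    (h : ∀ i ∈ s, φ i ∈ juntaSpan R X m a) : ∏ i ∈ s, φ i ∈ juntaSpan R X m (s.card * a) := by
  classical
  induction s using Finset.induction_on with
  | empty => exact const_mem_juntaSpan m _ 1
  | insert i s hi ih =>
    rw [Finset.prod_insert hi, Finset.card_insert_of_notMem hi, add_mul, one_mul, add_comm]
    exact mul_mem_juntaSpan (h i (by simp)) (ih fun j hj => h j (by simp [hj]))

theorem pow_mem_juntaSpan {m a : ℕ} {φ : (Fin m → X) → R} (h : φ ∈ juntaSpan R X m a) (n : ℕ) :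
    φ ^ n ∈ juntaSpan R X m (n * a) := by
  simpa using prod_mem_juntaSpan (Finset.range n) (φ := fun _ => φ) fun _ _ => h

theorem sum_neg_one_pow_card_mul_eq_zero {ι : Type*} [Fintype ι] [DecidableEq ι] {i : ι}
    {Φ : Finset ι → R} (hΦ : ∀ T, Φ (insert i T) = Φ T) :
    ∑ T : Finset ι, (-1) ^ T.card * Φ T = 0 := by
  refine Finset.sum_involution (fun T _ => if i ∈ T then T.erase i else insert i T)
    ?_ ?_ (fun _ _ => Finset.mem_univ _) ?_
  · intro T _
    by_cases hT : i ∈ T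
    · have h := hΦ (T.erase i)
      rw [Finset.insert_erase hT] at h
      rw [if_pos hT, h, ← Finset.card_erase_add_one hT, pow_succ]
      ring
    · rw [if_neg hT, hΦ, Finset.card_insert_of_notMem hT, pow_succ]
      ring
  · intro T _ _ h
    split_ifs at h with hT
    · exact Finset.erase_eq_self.1 h hT
    · exact hT (h ▸ Finset.mem_insert_self i T)
  · intro T _
    by_cases hT : i ∈ T
    · simp [hT, Finset.insert_erase]
    · simp [hT]

/-- A sum of functions depending on fewer than `m` variables that vanishes as soon as one of its
`m` variables equals `b` is zero. -/
theorem eq_zero_of_mem_juntaSpan {m d : ℕ} (hd : d < m) {φ : (Fin m → X) → R}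
    (hφ : φ ∈ juntaSpan R X m d) (b : X) (habs : ∀ x i, x i = b → φ x = 0) : φ = 0 := by
  classical
  funext x
  have hsum : ∀ φ ∈ juntaSpan R X m d,
      ∑ T : Finset (Fin m), (-1) ^ T.card * φ (T.piecewise (fun _ => b) x) = 0 := by
    intro φ hφ
    induction hφ using Submodule.span_induction with
    | zero => simp
    | add φ ψ _ _ h₁ h₂ => simp [mul_add, Finset.sum_add_distrib, h₁, h₂]
    | smul r φ _ h =>
      simp only [Pi.smul_apply, smul_eq_mul, mul_left_comm _ r]
      rw [← Finset.mul_sum, h, mul_zero]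
    | mem φ h =>
      obtain ⟨S, hS, hφ⟩ := h
      obtain ⟨i, hi⟩ : ∃ i, i ∉ S := by
        by_contra! hall
        rw [Finset.eq_univ_of_forall hall, Finset.card_univ, Fintype.card_fin] at hS
        omega
      refine sum_neg_one_pow_card_mul_eq_zero (i := i)
        (Φ := fun T => φ (T.piecewise (fun _ => b) x)) fun T => hφ fun j hj => ?_
      have hji : j ≠ i := by rintro rfl; exact hi hj
      simp [Finset.piecewise, hji]
  have h := hsum φ hφ
  rw [Finset.sum_eq_single ∅ ?_ (by simp)] at h
  · simpa using h
  · intro T _ hT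
    obtain ⟨i, hi⟩ := Finset.nonempty_iff_ne_empty.2 hT
    rw [habs _ i (by simp [hi]), mul_zero]

end Junta

section DegreeBound

variable {G : Type*} [Group G]

theorem eq_of_forall_update_mul_eq {α : Type*} {k : ℕ} {N : Subgroup G} {v : (Fin k → G) → α}
    (h : ∀ x j, ∀ z ∈ N, v (Function.update x j (x j * z)) = v x) {x y : Fin k → G}
    (hxy : ∀ j, (x j : G ⧸ N) = y j) : v x = v y := by
  have key : ∀ s : Finset (Fin k), v (s.piecewise y x) = v x := by
    intro s
    induction s using Finset.induction_on with
    | empty => simp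
    | insert j s hj ih =>
      rw [Finset.piecewise_insert, ← ih,
        ← h (s.piecewise y x) j ((x j)⁻¹ * y j) (QuotientGroup.eq.1 (hxy j))]
      simp [hj]
  simpa using (key Finset.univ).symm

theorem InClone.term_induction {A : Type*} {F : Set (FinOp A)} {n : ℕ}
    {P : ((Fin n → A) → A) → Prop} (proj : ∀ i, P fun x => x i)
    (app : ∀ (k : ℕ) (f : (Fin k → A) → A), (⟨k, f⟩ : FinOp A) ∈ F →
      ∀ g : Fin k → (Fin n → A) → A, (∀ i, InClone F (g i)) → (∀ i, P (g i)) →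
        P fun x => f fun i => g i x)
    {h : (Fin n → A) → A} (hh : InClone F h) : P h := by
  have key : ∀ {k : ℕ} {f : (Fin k → A) → A}, InClone F f →
      ∀ g : Fin k → (Fin n → A) → A, (∀ i, InClone F (g i)) → (∀ i, P (g i)) →
        P fun x => f fun i => g i x := by
    intro k f hf
    induction hf with
    | proj i => exact fun g _ hg => hg i
    | base f hf => exact app _ f hf
    | comp f e hf he ihf ihe =>
      exact fun g hgc hg => ihf (fun i x => e i fun j => g j x)
        (fun i => .comp _ _ (he i) hgc) fun i => ihe i g hgc hg
  exact key hh (fun i x => x i) (fun i => .proj i) proj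

/-- Every function of the classes modulo `N` of the values of a member of the clone generated by
`F` is a sum of functions depending on at most `D` variables. -/
def DegreeBoundedMod (p : ℕ) (F : Set (FinOp G)) (N : Subgroup G) (D : ℕ) : Prop :=
  ∀ (m : ℕ) (h : (Fin m → G) → G), InClone F h → ∀ u : G → ZMod p,
    (∀ g, ∀ z ∈ N, u (g * z) = u g) → (fun x => u (h x)) ∈ juntaSpan (ZMod p) G m D

variable {p : ℕ}

theorem degreeBoundedMod_top (F : Set (FinOp G)) : DegreeBoundedMod p F ⊤ 0 := by
  intro m h _ u hu
  have : (fun x => u (h x)) = fun _ => u 1 :=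
    funext fun x => by simpa using hu 1 (h x) trivial
  rw [this]
  exact const_mem_juntaSpan m 0 _

variable [Fact p.Prime]

theorem exists_affine_coefficient {N M : Subgroup G} [hN : N.Normal] [hM : M.Normal]
    (hcomm : compCommutator ⊤ N ≤ M) (l : N →* Multiplicative (ZMod p))
    (hker : ∀ z, l z = 1 ↔ (z : G) ∈ M) (hsurj : Function.Surjective l) {q : G → ZMod p}
    (hq : ∀ g (z : N), q (g * z) = q g + (l z).toAdd) {k : ℕ} {f : (Fin k → G) → G}
    (hf : Compatible f) (j : Fin k) :
    ∃ s : ZMod p, ∀ x (z : N), q (f (Function.update x j (x j * z))) = q (f x) + s * (l z).toAdd := by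
  let D : (Fin k → G) → G → G := fun y z => (f y)⁻¹ * f (Function.update y j (y j * z))
  have hf' := compatible_iff.1 hf
  have hD1 : ∀ y, D y 1 = 1 := by simp [D]
  have hD : JointCompatible D := by
    intro K hK y y' z z' hy hz
    simp only [D, QuotientGroup.mk_mul, QuotientGroup.mk_inv]
    rw [hf' K hK y y' hy, hf' K hK (Function.update y j (y j * z))
      (Function.update y' j (y' j * z')) fun i => ?_]
    rcases eq_or_ne i j with rfl | h
    · simp [hy, hz]
    · simp [h, hy]
  have hDmem : ∀ (K : Subgroup G), K.Normal → ∀ y, ∀ z ∈ K, D y z ∈ K := by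
    intro K hK y z hz
    have := hD K hK y y z 1 (fun _ => rfl) ((QuotientGroup.eq_one_iff _).2 hz)
    rwa [hD1, QuotientGroup.mk_one, QuotientGroup.eq_one_iff] at this
  have hindep : ∀ y (z : N), l ⟨D y z, hDmem N hN y z z.2⟩ = l ⟨D 1 z, hDmem N hN 1 z z.2⟩ := by
    intro y z
    have hc : JointCompatible fun y z => (D 1 z)⁻¹ * D y z := by
      intro K hK y y' z z' hy hz
      simp only [QuotientGroup.mk_mul, QuotientGroup.mk_inv]
      rw [hD K hK y y' z z' hy hz, hD K hK 1 1 z z' (fun _ => rfl) hz]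
    have hmem : (D 1 z)⁻¹ * D y z ∈ M :=
      hcomm (mem_compCommutator hc (by simp) (by simp [hD1]) (fun _ => Subgroup.mem_top _) z.2)
    have := (hker (⟨D 1 z, hDmem N hN 1 z z.2⟩⁻¹ * ⟨D y z, hDmem N hN y z z.2⟩)).2 hmem
    rw [map_mul, map_inv, inv_mul_eq_one] at this
    exact this.symm
  let ψ : N →* Multiplicative (ZMod p) :=
    MonoidHom.mk' (fun z => l ⟨D 1 z, hDmem N hN 1 z z.2⟩) fun a b => by
      rw [← hindep (Function.update 1 j (a : G)) b, ← map_mul]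
      congr 1
      ext
      simp [D]
  have hψ : ∀ z, l z = 1 → ψ z = 1 := fun z hz => (hker _).2 (hDmem M hM 1 z ((hker z).1 hz))
  obtain ⟨z₀, hz₀⟩ := hsurj (Multiplicative.ofAdd 1)
  refine ⟨(ψ z₀).toAdd, fun x z => ?_⟩
  have hx : f (Function.update x j (x j * z)) = f x * (⟨D x z, hDmem N hN x z z.2⟩ : N) := by
    simp [D]
  have hlpow : l (z₀ ^ ((l z).toAdd).val) = l z := by
    rw [map_pow, hz₀, ← ofAdd_nsmul]
    simp
  have hψz : ψ z = ψ z₀ ^ ((l z).toAdd).val := by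
    rw [← map_pow]
    have := hψ ((z₀ ^ ((l z).toAdd).val)⁻¹ * z) (by rw [map_mul, map_inv, hlpow, inv_mul_cancel])
    rw [map_mul, map_inv, inv_mul_eq_one] at this
    exact this.symm
  rw [hx, hq, hindep]
  change _ + (ψ z).toAdd = _
  rw [hψz, toAdd_pow]
  simp [mul_comm]

theorem DegreeBoundedMod.step [Finite G] {F : Set (FinOp G)} (hF : ∀ f ∈ F, Compatible f.2) {K : ℕ}
    (hK : ∀ f ∈ F, f.1 ≤ K) {N M : Subgroup G} [hN : N.Normal] [hM : M.Normal]
    (hcomm : compCommutator ⊤ N ≤ M) (l : N →* Multiplicative (ZMod p))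
    (hker : ∀ z, l z = 1 ↔ (z : G) ∈ M) (hsurj : Function.Surjective l) {D : ℕ}
    (hD : DegreeBoundedMod p F N D) : ∃ D', DegreeBoundedMod p F M D' := by
  classical
  have := Fintype.ofFinite (G ⧸ N)
  have hout : ∀ g : G, (Quotient.out (g : G ⧸ N))⁻¹ * g ∈ N := fun g =>
    QuotientGroup.eq.1 (QuotientGroup.out_eq' _)
  let q : G → ZMod p := fun g => (l ⟨_, hout g⟩).toAdd
  have hq : ∀ g (z : N), q (g * z) = q g + (l z).toAdd := by
    intro g z
    simp only [q]
    rw [← toAdd_mul, ← map_mul]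
    congr 2
    ext
    have : ((g * z : G) : G ⧸ N) = g := by simp
    simp [this, mul_assoc]
  have hind : ∀ w : G ⧸ N, ∀ {m : ℕ} {h : (Fin m → G) → G}, InClone F h →
      (fun x => if (h x : G ⧸ N) = w then (1 : ZMod p) else 0) ∈ juntaSpan (ZMod p) G m D := by
    intro w m h hh
    refine hD m h hh (fun g => if (g : G ⧸ N) = w then (1 : ZMod p) else 0) fun g z hz => ?_
    have : ((g * z : G) : G ⧸ N) = g := by simpa using hz
    simp [this]
  have hqdeg : ∀ {m : ℕ} {h : (Fin m → G) → G}, InClone F h →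
      (fun x => q (h x)) ∈ juntaSpan (ZMod p) G m (max 1 (K * D)) := by
    intro m h hh
    refine InClone.term_induction
      (P := fun h => (fun x => q (h x)) ∈ juntaSpan (ZMod p) G m (max 1 (K * D)))
      (fun i => apply_mem_juntaSpan (le_max_left _ _) q i) ?_ hh
    intro k f hf g hg ih
    choose s hs using
      exists_affine_coefficient hcomm l hker hsurj hq (hF _ hf)
    let v : (Fin k → G) → ZMod p := fun x => q (f x) - ∑ j, s j * q (x j)
    have hv : ∀ x j, ∀ z ∈ N, v (Function.update x j (x j * z)) = v x := by
      intro x j z hz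
      simp only [v]
      rw [hs j x ⟨z, hz⟩, ← Finset.add_sum_erase _ _ (Finset.mem_univ j),
        ← Finset.add_sum_erase _ _ (Finset.mem_univ j)]
      have h₁ : ∑ i ∈ Finset.univ.erase j, s i * q (Function.update x j (x j * z) i) =
          ∑ i ∈ Finset.univ.erase j, s i * q (x i) :=
        Finset.sum_congr rfl fun i hi => by simp [Finset.ne_of_mem_erase hi]
      have h₂ : q (x j * z) = q (x j) + (l ⟨z, hz⟩).toAdd := hq (x j) ⟨z, hz⟩
      rw [h₁, Function.update_self, h₂]
      ring
    have hsplit : (fun x => q (f fun i => g i x)) =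
        (∑ w : Fin k → G ⧸ N, v (fun j => (w j).out) •
          ∏ j, fun x => if (g j x : G ⧸ N) = w j then (1 : ZMod p) else 0) +
        ∑ j, s j • fun x => q (g j x) := by
      funext x
      have h₁ : v (fun j => g j x) = v (fun j => Quotient.out (g j x : G ⧸ N)) :=
        eq_of_forall_update_mul_eq hv fun j => (QuotientGroup.out_eq' _).symm
      have h₂ : q (f fun i => g i x) = v (fun j => g j x) + ∑ j, s j * q (g j x) := by simp [v]
      rw [h₂, h₁]
      simp only [Pi.add_apply, Finset.sum_apply, Pi.smul_apply, Finset.prod_apply, smul_eq_mul,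
        Finset.prod_ite_zero, Finset.mem_univ, true_implies, Finset.prod_const_one]
      rw [Finset.sum_eq_single (fun j => (g j x : G ⧸ N))]
      · simp
      · intro w _ hw
        rw [if_neg fun h => hw (funext fun j => (h j).symm), mul_zero]
      · simp
    rw [hsplit]
    refine add_mem (sum_mem fun w _ => Submodule.smul_mem _ _ ?_)
      (sum_mem fun j _ => Submodule.smul_mem _ _ (ih j))
    refine juntaSpan_mono ?_ (prod_mem_juntaSpan Finset.univ fun j _ => hind (w j) (hg j))
    simpa using Or.inr (Nat.mul_le_mul_right D (hK _ hf))
  refine ⟨D + (p - 1) * max 1 (K * D), fun m h hh u hu => ?_⟩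
  have hfac : ∀ g g' : G, (g : G ⧸ N) = g' → q g = q g' → u g = u g' := by
    intro g g' hgg' hqq'
    have hz := QuotientGroup.eq.1 hgg'
    have h₁ := hq g ⟨_, hz⟩
    rw [mul_inv_cancel_left, ← hqq', left_eq_add, toAdd_eq_zero, hker] at h₁
    simpa using (hu g _ h₁).symm
  let U : G ⧸ N → ZMod p → ZMod p := fun w a =>
    if h : ∃ g : G, (g : G ⧸ N) = w ∧ q g = a then u h.choose else 0
  have hU : ∀ g : G, U (g : G ⧸ N) (q g) = u g := by
    intro g
    have h : ∃ g' : G, (g' : G ⧸ N) = (g : G ⧸ N) ∧ q g' = q g := ⟨g, rfl, rfl⟩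
    simp only [U, dif_pos h]
    exact hfac _ _ h.choose_spec.1 h.choose_spec.2
  have hpow : ∀ b : ZMod p, 1 - b ^ (p - 1) = if b = 0 then 1 else 0 := by
    intro b
    have hp : p - 1 ≠ 0 := Nat.sub_ne_zero_of_lt (Fact.out : p.Prime).one_lt
    split_ifs with hb
    · simp [hb, hp]
    · rw [ZMod.pow_card_sub_one_eq_one hb, sub_self]
  have hsplit : (fun x => u (h x)) = ∑ w : G ⧸ N, ∑ a : ZMod p, U w a •
      ((fun x => if (h x : G ⧸ N) = w then (1 : ZMod p) else 0) *
        ((fun _ => 1) - ((fun x => q (h x)) - fun _ => a) ^ (p - 1))) := by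
    funext x
    simp only [Finset.sum_apply, Pi.smul_apply, Pi.mul_apply, Pi.sub_apply, Pi.pow_apply,
      smul_eq_mul, hpow, sub_eq_zero]
    simp [hU]
  rw [hsplit]
  refine sum_mem fun w _ => sum_mem fun a _ => Submodule.smul_mem _ _
    (mul_mem_juntaSpan (hind w hh) (sub_mem (const_mem_juntaSpan _ _ _)
      (pow_mem_juntaSpan (sub_mem (hqdeg hh) (const_mem_juntaSpan _ _ _)) _)))

theorem exists_index_prime_character [Finite G] (hG : IsPGroup p G) {N K : Subgroup G}
    (hKN : K < N) (hcomm : ∀ y : G, ∀ z ∈ N, y * z * y⁻¹ * z⁻¹ ∈ K) :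
    ∃ M : Subgroup G, M.Normal ∧ K ≤ M ∧ M < N ∧ ∃ l : N →* Multiplicative (ZMod p),
      (∀ z, l z = 1 ↔ (z : G) ∈ M) ∧ Function.Surjective l := by
  obtain ⟨n, hn⟩ := IsPGroup.iff_card.1 (hG.to_subgroup N)
  obtain ⟨k, hk⟩ := IsPGroup.iff_card.1 (hG.to_subgroup K)
  have hp : p.Prime := Fact.out
  have hkn : k < n := by
    refine (Nat.pow_lt_pow_iff_right hp.one_lt).1 ?_
    rw [← hn, ← hk]
    exact Set.ncard_lt_ncard (SetLike.coe_ssubset_coe.2 hKN) (Set.toFinite _)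
  have hcard : Nat.card (K.subgroupOf N) = p ^ k := by
    rw [← hk]
    exact Nat.card_congr (Subgroup.subgroupOfEquivOfLe hKN.le).toEquiv
  obtain ⟨M', hM', hle⟩ := Sylow.exists_subgroup_card_pow_prime_le p (m := n - 1)
    (hn ▸ pow_dvd_pow p (Nat.sub_le n 1)) (K.subgroupOf N) hcard (by omega)
  have hKM : K ≤ M'.map N.subtype := fun x hx => ⟨⟨x, hKN.le hx⟩, hle hx, rfl⟩
  have hmem : ∀ z : N, z ∈ M' ↔ (z : G) ∈ M'.map N.subtype := fun z => by simp
  have hMN : M'.map N.subtype ≤ N := Subgroup.map_subtype_le M'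
  have hMnormal : (M'.map N.subtype).Normal := by
    refine ⟨fun x hx y => ?_⟩
    have := mul_mem (hKM (hcomm y x (hMN hx))) hx
    simpa using this
  have hM'normal : M'.Normal :=
    ⟨fun x hx y => (hmem _).2 (by simpa using hMnormal.conj_mem x ((hmem x).1 hx) y)⟩
  have hquot : Nat.card (N ⧸ M') = p := by
    have h := Subgroup.card_eq_card_quotient_mul_card_subgroup M'
    rw [hn, hM', ← Nat.sub_add_cancel (show 1 ≤ n by omega), pow_succ', Nat.add_sub_cancel] at h
    exact (Nat.eq_of_mul_eq_mul_right (pow_pos hp.pos _) h).symm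
  have e : N ⧸ M' ≃* Multiplicative (ZMod p) :=
    mulEquivOfPrimeCardEq hquot (by rw [Nat.card_congr Multiplicative.toAdd, Nat.card_zmod])
  refine ⟨_, hMnormal, hKM, lt_of_le_of_ne hMN fun h => ?_,
    e.toMonoidHom.comp (QuotientGroup.mk' M'), fun z => ?_,
    e.surjective.comp (QuotientGroup.mk'_surjective M')⟩
  · have hcardM : Nat.card (M'.map N.subtype) = p ^ (n - 1) := by
      rw [← hM']
      exact Nat.card_congr (M'.equivMapOfInjective _ N.subtype_injective).symm.toEquiv
    rw [h, hn] at hcardM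
    have := Nat.pow_right_injective hp.two_le hcardM
    omega
  · rw [← hmem]
    simp

end DegreeBound

section Splitting

variable {G : Type*} [Group G] [Finite G]

theorem exists_degreeBoundedMod_bot (hL : SimpleLattice {N : Subgroup G // N.Normal})
    (hcard : ¬ Nat.card {N : Subgroup G // N.Normal} ≤ 2) {p : ℕ} [Fact p.Prime]
    (hG : IsPGroup p G) {F : Set (FinOp G)} (hF : ∀ f ∈ F, Compatible f.2) {K : ℕ}
    (hK : ∀ f ∈ F, f.1 ≤ K) : ∃ D, DegreeBoundedMod p F ⊥ D := by
  suffices H : ∀ N : Subgroup G, N.Normal → ∀ D, DegreeBoundedMod p F N D →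
      ∃ D', DegreeBoundedMod p F ⊥ D' from H ⊤ inferInstance 0 (degreeBoundedMod_top F)
  intro N
  induction N using WellFoundedLT.induction with
  | ind N ih =>
    intro hN D hD
    by_cases hbot : N = ⊥
    · exact ⟨D, hbot ▸ hD⟩
    have hlt := compCommutator_top_lt hL hcard hbot
    obtain ⟨M, hM, hKM, hMN, l, hker, hsurj⟩ :=
      exists_index_prime_character hG hlt fun y z hz => commutator_mem_compCommutator y hz
    obtain ⟨D', hD'⟩ := hD.step hF hK hKM l hker hsurj
    exact ih M hMN hM D' hD'

theorem exists_mem_center_ne_one (hL : SimpleLattice {N : Subgroup G // N.Normal})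
    (hcard : ¬ Nat.card {N : Subgroup G // N.Normal} ≤ 2) : ∃ z ∈ Subgroup.center G, z ≠ 1 := by
  suffices H : ∀ N : Subgroup G, N.Normal → N ≠ ⊥ → ∃ z ∈ Subgroup.center G, z ≠ 1 by
    refine H ⊤ inferInstance fun h => ?_
    have := hL.1
    exact top_ne_bot (α := {N : Subgroup G // N.Normal}) (Subtype.ext h)
  intro N
  induction N using WellFoundedLT.induction with
  | ind N ih =>
    intro hN hbot
    by_cases hC : compCommutator ⊤ N = ⊥
    · obtain ⟨z, hz, hz1⟩ : ∃ z ∈ N, z ≠ 1 := by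
        by_contra! h
        exact hbot (Subgroup.eq_bot_iff_forall _ |>.2 h)
      refine ⟨z, Subgroup.mem_center_iff.2 fun y => ?_, hz1⟩
      have := commutator_mem_compCommutator y hz
      rw [hC, Subgroup.mem_bot, mul_inv_eq_one, mul_inv_eq_iff_eq_mul] at this
      exact this
    · exact ih _ (compCommutator_top_lt hL hcard hbot) inferInstance hC

open Classical in
theorem not_compFG_of_latticeSplits (hL : SimpleLattice {N : Subgroup G // N.Normal})
    (hcard : ¬ Nat.card {N : Subgroup G // N.Normal} ≤ 2)
    (hsplit : LatticeSplits {N : Subgroup G // N.Normal}) : ¬ CompFG G := by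
  rintro ⟨F, hfin, hF, hgen⟩
  obtain ⟨z, hz, hz1⟩ := exists_mem_center_ne_one hL hcard
  obtain ⟨p, hp, hG⟩ := exists_isPGroup_of_simpleLattice hL hz hz1
  have := Fact.mk hp
  obtain ⟨K, hK⟩ := (hfin.image Sigma.fst).bddAbove
  obtain ⟨D, hD⟩ := exists_degreeBoundedMod_bot hL hcard hG (fun f hf => (hF f hf).2) (K := K)
    fun f hf => hK ⟨f, hf, rfl⟩
  obtain ⟨δ, ε, hδ, hε, hδε⟩ := hsplit
  obtain ⟨g, hg⟩ : ∃ g, g ∉ δ.1 := by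
    by_contra! h
    exact hδ.ne (Subtype.ext (Subgroup.eq_top_iff' _ |>.2 h))
  obtain ⟨e, he, he1⟩ : ∃ e ∈ ε.1, e ≠ 1 := by
    by_contra! h
    exact hε.ne' (Subtype.ext (Subgroup.eq_bot_iff_forall _ |>.2 h))
  let f : (Fin (D + 1) → G) → G := fun x => if ∀ i, x i ∉ δ.1 then e else 1
  have hf : Compatible f := by
    intro N hN a b hab
    have hfε : ∀ x, f x ∈ ε.1 := fun x => by
      simp only [f]
      split_ifs
      exacts [he, one_mem _]
    rcases hδε ⟨N, hN⟩ with h | h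
    · have hiff : ∀ i, a i ∈ δ.1 ↔ b i ∈ δ.1 := fun i => by
        constructor
        · intro ha
          simpa using mul_mem ha (h (hab i))
        · intro hb
          simpa using mul_mem hb (inv_mem (h (hab i)))
      have : f a = f b := by simp only [f, hiff]
      simp [this]
    · exact h (mul_mem (inv_mem (hfε a)) (hfε b))
  have hmem := hD (D + 1) f ((hgen (D + 1) (by omega) f).1 hf)
    (fun x => if x = e then 1 else 0) (by simp)
  have hzero := eq_zero_of_mem_juntaSpan (Nat.lt_succ_self D) hmem 1 fun x i hi => by
    have : ¬ ∀ i, x i ∉ δ.1 := fun h => h i (hi ▸ one_mem _)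
    simp [f, this, he1.symm]
  have := congrFun hzero fun _ => g
  simp [f, hg] at this

end Splitting

/-- Theorem (Mal'cev algebras with simple congruence lattice, instance for
finite groups): if the lattice `L` of normal subgroups of a finite group `G`
is simple, then `Comp G` is finitely generated iff `L` does not split or
`|L| ≤ 2`. -/
theorem compFG_iff_of_simple_lattice (G : Type*) [Group G] [Finite G]
    (hsimple : SimpleLattice {N : Subgroup G // N.Normal}) :
    CompFG G ↔
      (¬ LatticeSplits {N : Subgroup G // N.Normal} ∨
        Nat.card {N : Subgroup G // N.Normal} ≤ 2) := by
  constructor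
  · intro h
    by_contra! hc
    exact not_compFG_of_latticeSplits hsimple (by omega) hc.1 h
  · rintro (h | h)
    exacts [compFG_of_not_latticeSplits h, compFG_of_card_le h]
end

section
/- Let G be a group and let N be a normal subgroup of G that cuts the lattice of normal subgroups of G. If the clone Comp(G) of congruence preserving functions of G is finitely generated, then the clone Comp(G/N) of congruence preserving functions of the quotient group G/N is finitely generated. -/
theorem InClone.compatible {G : Type*} [Group G] {F : Set (FinOp G)}
    (hF : ∀ f ∈ F, Compatible f.2) {n : ℕ} {f : (Fin n → G) → G} (hf : InClone F f) :
    Compatible f := by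
  induction hf with
  | proj i => exact fun _ _ _ _ h => h i
  | base f hf => exact hF _ hf
  | comp f g _ _ ihf ihg => exact fun M hM a b h => ihf M hM _ _ fun i => ihg i M hM a b h

/-- The operation on `G ⧸ N` obtained by applying `f` to coset representatives. -/
noncomputable def quotientOp {G : Type*} [Group G] (N : Subgroup G) {n : ℕ}
    (f : (Fin n → G) → G) (x : Fin n → G ⧸ N) : G ⧸ N :=
  (f fun i => (x i).out : G)

theorem Compatible.quotientOp_mk {G : Type*} [Group G] {N : Subgroup G} [hN : N.Normal] {n : ℕ}
    {f : (Fin n → G) → G} (hf : Compatible f) (a : Fin n → G) :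
    quotientOp N f (fun i => (a i : G ⧸ N)) = (f a : G ⧸ N) :=
  QuotientGroup.eq.2 <| hf N hN _ _ fun _ => QuotientGroup.eq.1 (QuotientGroup.out_eq' _)

theorem Compatible.quotientOp {G : Type*} [Group G] {N : Subgroup G} [N.Normal] {n : ℕ}
    {f : (Fin n → G) → G} (hf : Compatible f) : Compatible (quotientOp N f) := by
  intro K hK x y h
  refine hf (K.comap (QuotientGroup.mk' N)) (hK.comap _) _ _ fun i => ?_
  simpa using h i

/-- A compatible function on `G ⧸ N` lifts to a compatible function on `G` if `N` cuts the
lattice of normal subgroups. -/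
theorem Compatible.lift_of_cut {G : Type*} [Group G] {N : Subgroup G} [N.Normal]
    (hcut : ∀ M : Subgroup G, M.Normal → M ≤ N ∨ N ≤ M) {n : ℕ}
    {h : (Fin n → G ⧸ N) → G ⧸ N} (hh : Compatible h) :
    Compatible fun a : Fin n → G => (h fun i => (a i : G ⧸ N)).out := by
  intro M hM a b hab
  rcases hcut M hM with hMN | hNM
  · have hmk : (fun i => (a i : G ⧸ N)) = fun i => (b i : G ⧸ N) :=
      funext fun i => QuotientGroup.eq.2 (hMN (hab i))
    simp [hmk, M.one_mem]
  · have hcomap : (M.map (QuotientGroup.mk' N)).comap (QuotientGroup.mk' N) = M :=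
      Subgroup.comap_map_eq_self (by simpa using hNM)
    have hmap := hh (M.map (QuotientGroup.mk' N))
      (hM.map _ (QuotientGroup.mk'_surjective N)) (fun i => (a i : G ⧸ N)) (fun i => (b i : G ⧸ N))
      fun i => ⟨_, hab i, rfl⟩
    rw [← hcomap, Subgroup.mem_comap]
    simpa using hmap

theorem InClone.exists_quotient {G : Type*} [Group G] {N : Subgroup G} [N.Normal]
    {F : Set (FinOp G)} (hF : ∀ f ∈ F, Compatible f.2) {n : ℕ} {f : (Fin n → G) → G}
    (hf : InClone F f) :
    ∃ g : (Fin n → G ⧸ N) → G ⧸ N,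
      InClone ((fun p : FinOp G => (⟨p.1, quotientOp N p.2⟩ : FinOp (G ⧸ N))) '' F) g ∧
        ∀ a : Fin n → G, g (fun i => (a i : G ⧸ N)) = (f a : G ⧸ N) := by
  induction hf with
  | proj i => exact ⟨_, .proj i, fun _ => rfl⟩
  | base f hf => exact ⟨_, .base _ ⟨_, hf, rfl⟩, (hF _ hf).quotientOp_mk⟩
  | comp f g _ _ ihf ihg =>
    obtain ⟨f', hf', hff'⟩ := ihf
    choose g' hg' hgg' using ihg
    exact ⟨_, .comp f' g' hf' hg', fun a => by simp only [hgg', hff']⟩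

/-- Lemma (instance for groups): if a normal subgroup `N` cuts the lattice of
normal subgroups of `G` and `Comp G` is finitely generated, then so is
`Comp (G ⧸ N)`. -/
theorem compFG_quotient (G : Type*) [Group G] (N : Subgroup G) [hN : N.Normal]
    (hcut : ∀ M : Subgroup G, M.Normal → M ≤ N ∨ N ≤ M)
    (hfg : CompFG G) : CompFG (G ⧸ N) := by
  obtain ⟨F, hfin, hF, hgen⟩ := hfg
  refine ⟨(fun p : FinOp G => (⟨p.1, quotientOp N p.2⟩ : FinOp (G ⧸ N))) '' F,
    hfin.image _, ?_, fun n hn h => ⟨fun hh => ?_, InClone.compatible ?_⟩⟩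
  · rintro _ ⟨p, hp, rfl⟩
    exact ⟨(hF p hp).1, (hF p hp).2.quotientOp⟩
  · obtain ⟨g, hg, hgh⟩ := InClone.exists_quotient (N := N) (fun f hf => (hF f hf).2)
      ((hgen n hn _).1 (hh.lift_of_cut hcut))
    have hgeq : g = h := by
      funext x
      simpa using hgh fun i => (x i).out
    exact hgeq ▸ hg
  · rintro _ ⟨p, hp, rfl⟩
    exact (hF p hp).2.quotientOp
end

section
/- Let G be a group and let D, E be normal subgroups of G forming a splitting pair (D, E) of the lattice of normal subgroups of G (i.e., D ≠ G, E ≠ {e}, and every normal subgroup N of G satisfies N ≤ D or N ≥ E). Let n ≥ 1, let a ∈ G, and let f : G^n → G be a function whose range is contained in the coset aE. Assume that for every b = (b_1,…,b_n) ∈ G^n there exists a compatible function g_b : G^n → G such that f(x) = g_b(x) for all x = (x_1,…,x_n) ∈ G^n with x_i⁻¹b_i ∈ D for all i. Then f is compatible. -/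
/-- Proposition (instance for groups): a function with range in a coset of
`E` which is interpolated on every `D`-class by a compatible function is
itself compatible, where `(D, E)` is a splitting pair of the lattice of
normal subgroups. -/
theorem compatible_of_splitting_pair (G : Type*) [Group G]
    (D E : Subgroup G) (hD : D.Normal) (hE : E.Normal)
    (hDtop : D ≠ ⊤) (hEbot : E ≠ ⊥)
    (hsplit : ∀ N : Subgroup G, N.Normal → N ≤ D ∨ E ≤ N)
    (n : ℕ) (hn : 1 ≤ n) (a : G) (f : (Fin n → G) → G)
    (hrange : ∀ x : Fin n → G, a⁻¹ * f x ∈ E)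
    (hinterp : ∀ b : Fin n → G, ∃ g : (Fin n → G) → G, Compatible g ∧
      ∀ x : Fin n → G, (∀ i, (x i)⁻¹ * b i ∈ D) → f x = g x) :
    Compatible f := by
  intro N hN x y hxy
  rcases hsplit N hN with h | h
  · obtain ⟨g, hg, hfg⟩ := hinterp y
    rw [hfg x fun i => h (hxy i), hfg y fun i => by simp]
    exact hg N hN x y hxy
  · have hmem := E.mul_mem (E.inv_mem (hrange x)) (hrange y)
    rw [show (a⁻¹ * f x)⁻¹ * (a⁻¹ * f y) = (f x)⁻¹ * f y by group] at hmem
    exact h hmem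
end
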